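/- Let $(M_i)_{i\in I}$ be a family of $R$-modules such that $H(M_i) = \bigcap_{n\ge 1}\mathfrak m^n M_i$ is radical for all but finitely many $i \in I$. Then with $M = \bigoplus_{i\in I} M_i$, $P = \prod_{i\in I} M_i$ and $A = \bigcap_{n\ge 1}(M + \mathfrak m^n P)$, the quotient $A/M$ is radical. -/

import Mathlib

/- Throughout, `(R, 𝔪)` is a commutative noetherian local ring and all modules are `R`-modules.
`AdicCompletion (maximalIdeal R) M` is the `𝔪`-adic completion `lim M/𝔪^n M` and
`IsHausdorff (maximalIdeal R) M` says that `M` is (`𝔪`-adically) separated. -/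

open TensorProduct IsLocalRing

universe u

section Definitions

variable (R : Type u) [CommRing R]

/-- A linear map is a *pure monomorphism* if it is injective and remains injective after
tensoring with an arbitrary module. -/
def IsPureMono {M N : Type u} [AddCommGroup M] [Module R M] [AddCommGroup N] [Module R N]
    (f : M →ₗ[R] N) : Prop :=
  Function.Injective f ∧
    ∀ (X : Type u) [AddCommGroup X] [Module R X], Function.Injective (LinearMap.lTensor X f)

/-- A module `N` is *pure-injective* if every pure monomorphism out of `N` splits. -/
def IsPureInjective (N : Type u) [AddCommGroup N] [Module R N] : Prop :=
  ∀ (Y : Type u) [AddCommGroup Y] [Module R Y] (f : N →ₗ[R] Y),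
    IsPureMono R f → ∃ g : Y →ₗ[R] N, g ∘ₗ f = LinearMap.id

/-- A submodule `A ⊆ B` is *pure* if its inclusion is a pure monomorphism. -/
def IsPureSubmodule {B : Type u} [AddCommGroup B] [Module R B] (A : Submodule R B) : Prop :=
  IsPureMono R A.subtype

/-- An extension `A ⊆ B` is *pure-essential* if `A` is pure in `B` and for every submodule
`X ⊆ B` with `X ⊓ A = 0` such that `(X ⊕ A)/X` is pure in `B/X`, one has `X = 0`. -/
def IsPureEssential {B : Type u} [AddCommGroup B] [Module R B] (A : Submodule R B) : Prop :=
  IsPureSubmodule R A ∧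
    ∀ X : Submodule R B, X ⊓ A = ⊥ → IsPureMono R (X.mkQ ∘ₗ A.subtype) → X = ⊥

/-- An extension `A ⊆ B` is *strictly pure-essential* if it is pure-essential and for every
extension `B ⊆ Y` in which `A` is pure in `Y`, also `B` is pure in `Y`. -/
def IsStrictlyPureEssential {B : Type u} [AddCommGroup B] [Module R B] (A : Submodule R B) :
    Prop :=
  IsPureEssential R A ∧
    ∀ (Y : Type u) [AddCommGroup Y] [Module R Y] (g : B →ₗ[R] Y),
      Function.Injective g → IsPureMono R (g ∘ₗ A.subtype) → IsPureMono R g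

/-- A module `M` over a local ring is *totally separated* if `X ⊗[R] M` is `𝔪`-adically
separated for every finitely generated `R`-module `X`. -/
def IsTotallySeparatedModule [IsLocalRing R] (M : Type u) [AddCommGroup M] [Module R M] :
    Prop :=
  ∀ (X : Type u) [AddCommGroup X] [Module R X] [Module.Finite R X],
    IsHausdorff (maximalIdeal R) (X ⊗[R] M)

end Definitions

/-- An element of `(g₁, …, gᵣ) • N` is a combination `∑ gₖ yₖ` with all `yₖ` in `N`. -/
theorem exists_sum_smul_of_mem_span_smul {R X : Type*} [CommRing R] [AddCommGroup X] [Module R X]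
    {r : ℕ} (g : Fin r → R) (N : Submodule R X) {x : X}
    (hx : x ∈ Ideal.span (Set.range g) • N) :
    ∃ y : Fin r → X, (∀ k, y k ∈ N) ∧ x = ∑ k, g k • y k := by
  induction hx using Submodule.smul_induction_on' with
  | smul a ha n hn =>
    obtain ⟨c, rfl⟩ := Ideal.mem_span_range_iff_exists_fun.1 ha
    refine ⟨fun k => c k • n, fun k => N.smul_mem _ hn, ?_⟩
    simp only [Finset.sum_smul, smul_smul, mul_comm]
  | add x _ x' _ h h' =>
    obtain ⟨y, hy, rfl⟩ := h
    obtain ⟨y', hy', rfl⟩ := h'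
    exact ⟨fun k => y k + y' k, fun k => N.add_mem (hy k) (hy' k), by
      simp [smul_add, Finset.sum_add_distrib]⟩

/-- For a finitely generated ideal `J`, membership in `J • ∏ M i` is checked componentwise. -/
theorem mem_smul_top_pi_iff {R ι : Type*} [CommRing R] {M : ι → Type*}
    [∀ i, AddCommGroup (M i)] [∀ i, Module R (M i)] {J : Ideal R} (hJ : J.FG)
    (x : (i : ι) → M i) :
    x ∈ J • (⊤ : Submodule R ((i : ι) → M i)) ↔
      ∀ i, x i ∈ J • (⊤ : Submodule R (M i)) := by
  constructor
  · intro hx i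
    have h := Submodule.mem_map_of_mem (f := LinearMap.proj (R := R) (φ := M) i) hx
    rw [Submodule.map_smul''] at h
    exact Submodule.smul_mono le_rfl le_top h
  · intro hx
    obtain ⟨r, g, hg⟩ := Submodule.fg_iff_exists_fin_generating_family.1 hJ
    obtain rfl : Ideal.span (Set.range g) = J := hg
    choose y _ hy using fun i => exists_sum_smul_of_mem_span_smul g ⊤ (hx i)
    have : x = ∑ k, g k • (fun i => y i k) := by
      ext i
      simpa [Finset.sum_apply] using hy i
    rw [this]
    exact Submodule.sum_mem _ fun k _ =>
      Submodule.smul_mem_smul (Ideal.subset_span ⟨k, rfl⟩) trivial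

/-- The direct sum inside the product consists of the families of finite support. -/
theorem mem_iSup_range_single_iff {R ι : Type*} [CommRing R] [DecidableEq ι] {M : ι → Type*}
    [∀ i, AddCommGroup (M i)] [∀ i, Module R (M i)] (x : (i : ι) → M i) :
    x ∈ ⨆ i, LinearMap.range (LinearMap.single R M i) ↔ {i | x i ≠ 0}.Finite := by
  constructor
  · intro hx
    induction hx using Submodule.iSup_induction' with
    | mem i x hx =>
      obtain ⟨y, rfl⟩ := hx
      refine (Set.finite_singleton i).subset fun j hj => ?_
      by_contra hne
      exact hj (Pi.single_eq_of_ne hne y)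
    | zero => simp
    | add x y _ _ hx hy =>
      refine (hx.union hy).subset fun j hj => ?_
      by_contra h
      simp only [Set.mem_union, Set.mem_ofPred_eq, not_or, not_not] at h
      exact hj (by simp [h.1, h.2])
  · intro hx
    have : x = ∑ i ∈ hx.toFinset, LinearMap.single R M i (x i) := by
      ext j
      rw [Finset.sum_apply]
      by_cases hj : x j = 0
      · rw [hj, Finset.sum_eq_zero]
        intro i _
        rcases eq_or_ne j i with rfl | h
        · simp [hj]
        · exact Pi.single_eq_of_ne h _
      · rw [Finset.sum_eq_single j]
        · simp
        · intro i _ h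
          exact Pi.single_eq_of_ne h.symm _
        · intro h
          simp [hj] at h
    rw [this]
    exact Submodule.sum_mem _ fun i _ => Submodule.mem_iSup_of_mem i ⟨x i, rfl⟩

/-- A family lies in `⨁ M i + J • ∏ M i` iff almost all of its members lie in `J • M i`. -/
theorem mem_iSup_range_single_sup_smul_top_iff {R ι : Type*} [CommRing R] [DecidableEq ι]
    {M : ι → Type*} [∀ i, AddCommGroup (M i)] [∀ i, Module R (M i)] {J : Ideal R} (hJ : J.FG)
    (x : (i : ι) → M i) :
    x ∈ (⨆ i, LinearMap.range (LinearMap.single R M i)) ⊔ J • ⊤ ↔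
      {i | x i ∉ J • (⊤ : Submodule R (M i))}.Finite := by
  classical
  constructor
  · intro hx
    obtain ⟨a, ha, b, hb, rfl⟩ := Submodule.mem_sup.1 hx
    refine ((mem_iSup_range_single_iff a).1 ha).subset fun i hi h0 => hi ?_
    simpa [h0] using (mem_smul_top_pi_iff hJ b).1 hb i
  · intro hx
    refine Submodule.mem_sup.2
      ⟨fun i => if x i ∈ J • (⊤ : Submodule R (M i)) then 0 else x i,
        (mem_iSup_range_single_iff _).2 (hx.subset fun i hi h => hi (if_pos h)),
        fun i => if x i ∈ J • (⊤ : Submodule R (M i)) then x i else 0,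
        (mem_smul_top_pi_iff hJ _).2 fun i => ?_, ?_⟩
    · split_ifs with h
      · exact h
      · exact zero_mem _
    · ext i
      simp only [Pi.add_apply]
      split_ifs <;> simp

/-- If `⋂ Iⁿ X` is `I`-radical, an element of `I • X` can be written as `∑ gₖ yₖ` such that
the `I`-adic order drops by at most one. -/
theorem exists_sum_smul_of_mem_pow_succ {R X : Type*} [CommRing R] [AddCommGroup X] [Module R X]
    {r : ℕ} (g : Fin r → R) {I : Ideal R} (hg : Ideal.span (Set.range g) = I)
    (hrad : I • (⨅ (n : ℕ) (_ : 1 ≤ n), I ^ n • (⊤ : Submodule R X)) =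
      ⨅ (n : ℕ) (_ : 1 ≤ n), I ^ n • (⊤ : Submodule R X))
    {x : X} (hx : x ∈ I • (⊤ : Submodule R X)) :
    ∃ y : Fin r → X, x = ∑ k, g k • y k ∧
      ∀ n, x ∈ I ^ (n + 1) • (⊤ : Submodule R X) → ∀ k, y k ∈ I ^ n • (⊤ : Submodule R X) := by
  classical
  subst hg
  set I := Ideal.span (Set.range g)
  by_cases hH : ∀ n, x ∈ I ^ n • (⊤ : Submodule R X)
  · have hx' : x ∈ ⨅ (n : ℕ) (_ : 1 ≤ n), I ^ n • (⊤ : Submodule R X) := by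
      simp only [Submodule.mem_iInf]
      exact fun n _ => hH n
    rw [← hrad] at hx'
    obtain ⟨y, hy, hxy⟩ := exists_sum_smul_of_mem_span_smul g _ hx'
    simp only [Submodule.mem_iInf] at hy
    refine ⟨y, hxy, fun n _ k => ?_⟩
    rcases Nat.eq_zero_or_pos n with rfl | hn
    · simp
    · exact hy k n hn
  · push Not at hH
    have hspec := Nat.find_spec hH
    have hmin : ∀ n, n < Nat.find hH → x ∈ I ^ n • (⊤ : Submodule R X) :=
      fun n hn => not_not.1 (Nat.find_min hH hn)
    set N := Nat.find hH
    obtain ⟨N', hN'⟩ : ∃ N', N = N' + 2 := by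
      refine ⟨N - 2, ?_⟩
      have h0 : N ≠ 0 := fun h => hspec (by simp [h])
      have h1 : N ≠ 1 := fun h => hspec (by simpa [h] using hx)
      omega
    have hx' := hmin (N' + 1) (by omega)
    rw [pow_succ', Submodule.mul_smul] at hx'
    obtain ⟨y, hy, hxy⟩ := exists_sum_smul_of_mem_span_smul g _ hx'
    refine ⟨y, hxy, fun n hn k => ?_⟩
    have hle : n ≤ N' := by
      by_contra h
      exact hspec (Submodule.smul_mono_left (Ideal.pow_le_pow_right (by omega)) hn)
    exact Submodule.smul_mono_left (Ideal.pow_le_pow_right hle) (hy k)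

/-- If `H(M i) = ⋂_{n ≥ 1} 𝔪^n M i` is radical for all but finitely many
`i`, then with `M = ⊕ M i ⊆ P = ∏ M i` and `A = ⋂_{n ≥ 1} (M + 𝔪^n P)`, the quotient
`A/M` is radical, i.e. `M + 𝔪 A = A`. -/
theorem closure_quotient_radical (R : Type u) [CommRing R] [IsNoetherianRing R] [IsLocalRing R]
    {ι : Type u} [DecidableEq ι] (M : ι → Type u)
    [∀ i, AddCommGroup (M i)] [∀ i, Module R (M i)]
    (hH : {i : ι | ¬ maximalIdeal R •
        (⨅ (n : ℕ) (_ : 1 ≤ n), maximalIdeal R ^ n • (⊤ : Submodule R (M i))) =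
      ⨅ (n : ℕ) (_ : 1 ≤ n), maximalIdeal R ^ n • (⊤ : Submodule R (M i))}.Finite)
    (Md A : Submodule R ((i : ι) → M i))
    (hMd : Md = ⨆ i, LinearMap.range (LinearMap.single R M i))
    (hA : A = ⨅ (n : ℕ) (_ : 1 ≤ n), (Md ⊔ maximalIdeal R ^ n • ⊤)) :
    Md ⊔ maximalIdeal R • A = A := by
  classical
  obtain ⟨r, g, hg⟩ := Submodule.fg_iff_exists_fin_generating_family.1
    (IsNoetherian.noetherian (maximalIdeal R))
  replace hg : Ideal.span (Set.range g) = maximalIdeal R := hg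
  have memA (x : (i : ι) → M i) : x ∈ A ↔
      ∀ n, {i | x i ∉ maximalIdeal R ^ n • (⊤ : Submodule R (M i))}.Finite := by
    subst hA hMd
    simp only [Submodule.mem_iInf,
      mem_iSup_range_single_sup_smul_top_iff (IsNoetherian.noetherian (maximalIdeal R ^ _))]
    refine ⟨fun h n => ?_, fun h n _ => h n⟩
    rcases Nat.eq_zero_or_pos n with rfl | hn
    · simp
    · exact h n hn
  have hle : Md ≤ A := hA ▸ le_iInf₂ fun _ _ => le_sup_left
  refine le_antisymm (sup_le hle Submodule.smul_le_right) fun x hx => ?_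
  let good (i : ι) : Prop := x i ∈ maximalIdeal R • (⊤ : Submodule R (M i)) ∧
    maximalIdeal R • (⨅ (n : ℕ) (_ : 1 ≤ n), maximalIdeal R ^ n • (⊤ : Submodule R (M i))) =
      ⨅ (n : ℕ) (_ : 1 ≤ n), maximalIdeal R ^ n • (⊤ : Submodule R (M i))
  have hbad : {i | ¬ good i}.Finite := by
    refine (((memA x).1 hx 1).union hH).subset fun i hi => ?_
    by_contra h
    simp only [Set.mem_union, Set.mem_ofPred_eq, not_or, not_not, pow_one] at h
    exact hi h
  have hdec (i : ι) : ∃ y : Fin r → M i, (good i → x i = ∑ k, g k • y k) ∧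
      ∀ n, x i ∈ maximalIdeal R ^ (n + 1) • (⊤ : Submodule R (M i)) →
        ∀ k, y k ∈ maximalIdeal R ^ n • (⊤ : Submodule R (M i)) := by
    by_cases h : good i
    · obtain ⟨y, hy, hy'⟩ := exists_sum_smul_of_mem_pow_succ g hg h.2 h.1
      exact ⟨y, fun _ => hy, hy'⟩
    · exact ⟨0, fun h' => absurd h' h, fun _ _ _ => zero_mem _⟩
  choose y hy hy' using hdec
  have hyA (k : Fin r) : (fun i => y i k) ∈ A :=
    (memA _).2 fun n => ((memA x).1 hx (n + 1)).subset fun i hi h => hi (hy' i n h k)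
  refine Submodule.mem_sup.2 ⟨x - ∑ k, g k • (fun i => y i k), ?_,
    ∑ k, g k • (fun i => y i k), ?_, sub_add_cancel _ _⟩
  · rw [hMd, mem_iSup_range_single_iff]
    refine hbad.subset fun i hi h => hi ?_
    simp only [Pi.sub_apply, Finset.sum_apply, Pi.smul_apply]
    exact sub_eq_zero.2 (hy i h)
  · exact Submodule.sum_mem _ fun k _ =>
      Submodule.smul_mem_smul (hg ▸ Ideal.subset_span ⟨k, rfl⟩) (hyA k)
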